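/- Let B₄(n) denote the number of permutations of length n containing exactly one 132 pattern and exactly four 123 patterns. Then in ℚ[[z]], the generating function G₄(z) = ∑_{n≥0} B₄(n)·zⁿ satisfies (1 - 2z)⁶·G₄(z) = z⁶·(z⁵ + 12z⁴ - 55z³ + 65z² - 30z + 5). -/

import Mathlib

/-- The number of 132 patterns of a permutation `π` of `Fin n`:
triples of indices `i₁ < i₂ < i₃` with `π i₁ < π i₃ < π i₂`. -/
def count132 {n : ℕ} (π : Equiv.Perm (Fin n)) : ℕ :=
  (Finset.univ.filter (fun p : Fin n × Fin n × Fin n =>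
    p.1 < p.2.1 ∧ p.2.1 < p.2.2 ∧ π p.1 < π p.2.2 ∧ π p.2.2 < π p.2.1)).card

/-- The number of 123 patterns of a permutation `π` of `Fin n`:
triples of indices `i₁ < i₂ < i₃` with `π i₁ < π i₂ < π i₃`. -/
def count123 {n : ℕ} (π : Equiv.Perm (Fin n)) : ℕ :=
  (Finset.univ.filter (fun p : Fin n × Fin n × Fin n =>
    p.1 < p.2.1 ∧ p.2.1 < p.2.2 ∧ π p.1 < π p.2.1 ∧ π p.2.1 < π p.2.2)).card

/-- The number of 12 patterns of a permutation `π` of `Fin n`: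
pairs of indices `i₁ < i₂` with `π i₁ < π i₂`. -/
def count12 {n : ℕ} (π : Equiv.Perm (Fin n)) : ℕ :=
  (Finset.univ.filter (fun p : Fin n × Fin n =>
    p.1 < p.2 ∧ π p.1 < π p.2)).card

/-- The number of permutations of length n with exactly one 132 pattern and exactly 4 123 patterns. -/
def B (n : ℕ) : ℕ :=
  (Finset.univ.filter (fun π : Equiv.Perm (Fin n) =>
    count132 π = 1 ∧ count123 π = 4)).card

/-! ### Pattern counting in words -/

/-- number of pairs (in order of position) of entries satisfying `R` -/
def cnt2 (R : ℕ → ℕ → Bool) : List ℕ → ℕ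
  | [] => 0
  | a :: l => l.countP (R a) + cnt2 R l

/-- number of triples (in order of position) of entries satisfying `R` -/
def cnt3 (R : ℕ → ℕ → ℕ → Bool) : List ℕ → ℕ
  | [] => 0
  | a :: l => cnt2 (R a) l + cnt3 R l

def R12 (a b : ℕ) : Bool := decide (a < b)
def R123 (a b c : ℕ) : Bool := decide (a < b ∧ b < c)
def R132 (a b c : ℕ) : Bool := decide (a < c ∧ c < b)

theorem cnt2_sublist (R : ℕ → ℕ → Bool) {l l' : List ℕ} (h : l.Sublist l') :
    cnt2 R l ≤ cnt2 R l' := by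
  induction h with
  | slnil => simp
  | cons a _ ih => simp only [cnt2]; omega
  | cons_cons a h ih =>
    simp only [cnt2]
    have := h.countP_le (p := R a)
    omega

theorem cnt3_sublist (R : ℕ → ℕ → ℕ → Bool) {l l' : List ℕ} (h : l.Sublist l') :
    cnt3 R l ≤ cnt3 R l' := by
  induction h with
  | slnil => simp
  | cons a _ ih => simp only [cnt3]; omega
  | cons_cons a h ih =>
    simp only [cnt3]
    have := cnt2_sublist (R a) h
    omega

theorem cnt2_map (R : ℕ → ℕ → Bool) (f : ℕ → ℕ) (l : List ℕ) :
    cnt2 R (l.map f) = cnt2 (fun a b => R (f a) (f b)) l := by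
  induction l with
  | nil => rfl
  | cons a l ih => simp [cnt2, ih, List.countP_map, Function.comp_def]

theorem cnt3_map (R : ℕ → ℕ → ℕ → Bool) (f : ℕ → ℕ) (l : List ℕ) :
    cnt3 R (l.map f) = cnt3 (fun a b c => R (f a) (f b) (f c)) l := by
  induction l with
  | nil => rfl
  | cons a l ih => simp [cnt3, ih, cnt2_map]

theorem cnt12_map {f : ℕ → ℕ} (hf : StrictMono f) (l : List ℕ) :
    cnt2 R12 (l.map f) = cnt2 R12 l := by
  rw [cnt2_map]; simp only [R12, hf.lt_iff_lt]; rfl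

theorem cnt123_map {f : ℕ → ℕ} (hf : StrictMono f) (l : List ℕ) :
    cnt3 R123 (l.map f) = cnt3 R123 l := by
  rw [cnt3_map]; simp only [R123, hf.lt_iff_lt]; rfl

theorem cnt132_map {f : ℕ → ℕ} (hf : StrictMono f) (l : List ℕ) :
    cnt3 R132 (l.map f) = cnt3 R132 l := by
  rw [cnt3_map]; simp only [R132, hf.lt_iff_lt]; rfl

/-! a word whose first entry is at least all the others -/

theorem cnt12_top {M : ℕ} {l : List ℕ} (h : ∀ b ∈ l, b < M) :
    cnt2 R12 (M :: l) = cnt2 R12 l := by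
  have : l.countP (R12 M) = 0 := by
    rw [List.countP_eq_zero]; intro b hb; have := h b hb; simp [R12]; omega
  simp [cnt2, this]

theorem cnt2_zero {R : ℕ → ℕ → Bool} {l : List ℕ} (h : ∀ a ∈ l, ∀ b ∈ l, R a b = false) :
    cnt2 R l = 0 := by
  induction l with
  | nil => rfl
  | cons a l ih =>
    have : l.countP (R a) = 0 := by
      rw [List.countP_eq_zero]; intro b hb; simp [h a (by simp) b (by simp [hb])]
    rw [cnt2, this, ih (fun a ha b hb => h a (by simp [ha]) b (by simp [hb]))]

theorem cnt123_top {M : ℕ} {l : List ℕ} (h : ∀ b ∈ l, b < M) :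
    cnt3 R123 (M :: l) = cnt3 R123 l := by
  rw [cnt3, cnt2_zero, zero_add]
  intro a ha b hb; have := h a ha; simp [R123]; omega

theorem cnt132_top {M : ℕ} {l : List ℕ} (h : ∀ b ∈ l, b < M) :
    cnt3 R132 (M :: l) = cnt3 R132 l := by
  rw [cnt3, cnt2_zero, zero_add]
  intro a ha b hb; have := h b hb; simp [R132]; omega

/-! adding a word `l` in front of `k ++ M :: l2`, where every entry of `l` is bigger than all
entries of `k` and `l2`, and less than `M`.-/

theorem countP12_app {a M : ℕ} {l k l2 : List ℕ} (hM : a < M)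
    (h2 : ∀ b ∈ l2, b < a) (hk : ∀ b ∈ k, b < a) :
    (l ++ (k ++ M :: l2)).countP (R12 a) = l.countP (R12 a) + 1 := by
  have e1 : l2.countP (R12 a) = 0 := by
    rw [List.countP_eq_zero]; intro b hb; have := h2 b hb; simp [R12]; omega
  have e2 : k.countP (R12 a) = 0 := by
    rw [List.countP_eq_zero]; intro b hb; have := hk b hb; simp [R12]; omega
  simp [List.countP_append, e1, e2, R12, hM]

theorem cnt12_app {M : ℕ} {l k l2 : List ℕ} (hM : ∀ a ∈ l, a < M)
    (h2 : ∀ a ∈ l, ∀ b ∈ l2, b < a) (hk : ∀ a ∈ l, ∀ b ∈ k, b < a) :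
    cnt2 R12 (l ++ (k ++ M :: l2)) = cnt2 R12 l + l.length + cnt2 R12 (k ++ M :: l2) := by
  induction l with
  | nil => simp [cnt2]
  | cons a l ih =>
    simp only [List.forall_mem_cons] at hM h2 hk
    rw [List.cons_append, cnt2, ih hM.2 h2.2 hk.2, cnt2, countP12_app hM.1 h2.1 hk.1,
      List.length_cons]
    ring

theorem countP123_zero {a c : ℕ} {l2 : List ℕ} (h2 : ∀ b ∈ l2, b < a) :
    l2.countP (R123 a c) = 0 := by
  rw [List.countP_eq_zero]; intro b hb; have := h2 b hb; simp [R123]; omega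

theorem countP132_zero {a c : ℕ} {l2 : List ℕ} (h2 : ∀ b ∈ l2, b < a) :
    l2.countP (R132 a c) = 0 := by
  rw [List.countP_eq_zero]; intro b hb; have := h2 b hb; simp [R132]; omega

theorem cnt123_app_aux0 {a M : ℕ} {k l2 : List ℕ}
    (h2 : ∀ b ∈ l2, b < a) (hk : ∀ b ∈ k, b < a) :
    cnt2 (R123 a) (k ++ M :: l2) = 0 := by
  induction k with
  | nil =>
    rw [List.nil_append, cnt2, countP123_zero h2, cnt2_zero]
    intro c hc b hb; have := h2 c hc; simp [R123]; omega
  | cons b k ih =>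
    simp only [List.forall_mem_cons] at hk
    rw [List.cons_append, cnt2, ih hk.2, add_zero, List.countP_eq_zero]
    intro c _; simp [R123]; omega

theorem cnt132_app_aux0 {a M : ℕ} {k l2 : List ℕ}
    (h2 : ∀ b ∈ l2, b < a) (hk : ∀ b ∈ k, b < a) :
    cnt2 (R132 a) (k ++ M :: l2) = 0 := by
  induction k with
  | nil =>
    rw [List.nil_append, cnt2, countP132_zero h2, cnt2_zero]
    intro c hc b hb; have := h2 b hb; simp [R132]; omega
  | cons b k ih =>
    simp only [List.forall_mem_cons] at hk
    rw [List.cons_append, cnt2, ih hk.2, add_zero, List.countP_eq_zero]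
    intro c _; simp [R132]; omega

theorem cnt123_app_aux {a M : ℕ} {l k l2 : List ℕ} (hM : ∀ b ∈ l, b < M)
    (h2 : ∀ b ∈ l2, b < a) (hk : ∀ b ∈ k, b < a) :
    cnt2 (R123 a) (l ++ (k ++ M :: l2)) = cnt2 (R123 a) l + l.countP (R12 a) := by
  induction l with
  | nil => simp [cnt2, cnt123_app_aux0 h2 hk]
  | cons b l ih =>
    simp only [List.forall_mem_cons] at hM
    rw [List.cons_append, cnt2, ih hM.2, cnt2, List.countP_append, List.countP_append,
      List.countP_cons, List.countP_cons, countP123_zero h2, countP123_zero hk]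
    simp [R123, R12, hM.1]
    ring

theorem cnt132_app_aux {a M : ℕ} {l k l2 : List ℕ} (hM : ∀ b ∈ l, b < M)
    (h2 : ∀ b ∈ l2, b < a) (hk : ∀ b ∈ k, b < a) :
    cnt2 (R132 a) (l ++ (k ++ M :: l2)) = cnt2 (R132 a) l := by
  induction l with
  | nil => simp [cnt2, cnt132_app_aux0 h2 hk]
  | cons b l ih =>
    simp only [List.forall_mem_cons] at hM
    rw [List.cons_append, cnt2, ih hM.2, cnt2, List.countP_append, List.countP_append,
      List.countP_cons, countP132_zero h2, countP132_zero hk]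
    have : ¬ M < b := by omega
    simp [R132, this]

theorem cnt123_app {M : ℕ} {l k l2 : List ℕ} (hM : ∀ a ∈ l, a < M)
    (h2 : ∀ a ∈ l, ∀ b ∈ l2, b < a) (hk : ∀ a ∈ l, ∀ b ∈ k, b < a) :
    cnt3 R123 (l ++ (k ++ M :: l2)) = cnt3 R123 l + cnt2 R12 l + cnt3 R123 (k ++ M :: l2) := by
  induction l with
  | nil => simp [cnt2, cnt3]
  | cons a l ih =>
    simp only [List.forall_mem_cons] at hM h2 hk
    rw [List.cons_append, cnt3, ih hM.2 h2.2 hk.2, cnt2, cnt3, cnt123_app_aux hM.2 h2.1 hk.1]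
    ring

theorem cnt132_app {M : ℕ} {l k l2 : List ℕ} (hM : ∀ a ∈ l, a < M)
    (h2 : ∀ a ∈ l, ∀ b ∈ l2, b < a) (hk : ∀ a ∈ l, ∀ b ∈ k, b < a) :
    cnt3 R132 (l ++ (k ++ M :: l2)) = cnt3 R132 l + cnt3 R132 (k ++ M :: l2) := by
  induction l with
  | nil => simp [cnt3]
  | cons a l ih =>
    simp only [List.forall_mem_cons] at hM h2 hk
    rw [List.cons_append, cnt3, ih hM.2 h2.2 hk.2, cnt3, cnt132_app_aux hM.2 h2.1 hk.1]
    ring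

/-! The base case of a crossing: `[k] ++ M :: l2`, with exactly one entry of `l2` above `k`. -/

theorem cross12 {k M : ℕ} {l2 : List ℕ} (hM : k < M) (h2 : ∀ b ∈ l2, b < M)
    (h1 : l2.countP (R12 k) = 1) :
    cnt2 R12 ([k] ++ M :: l2) = cnt2 R12 l2 + 2 := by
  rw [List.cons_append, List.nil_append, cnt2, cnt12_top h2, List.countP_cons, h1]
  simp [R12, hM]; ring

theorem cross_pair {k : ℕ} {l2 : List ℕ} (h1 : l2.countP (R12 k) ≤ 1)
    (R : ℕ → ℕ → Bool) (hR : ∀ a b, R a b = true → k < a ∧ k < b) :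
    cnt2 R l2 = 0 := by
  induction l2 with
  | nil => rfl
  | cons a l ih =>
    rw [List.countP_cons] at h1
    rw [cnt2, ih (by omega), add_zero, List.countP_eq_zero]
    intro b hb hab
    obtain ⟨ha, hb'⟩ := hR a b hab
    have : 0 < l.countP (R12 k) := List.countP_pos_iff.2 ⟨b, hb, by simp [R12, hb']⟩
    simp [R12, ha] at h1
    exact absurd (h1 b hb) (by omega)

theorem cross123 {k M : ℕ} {l2 : List ℕ} (h2 : ∀ b ∈ l2, b < M)
    (h1 : l2.countP (R12 k) = 1) :
    cnt3 R123 ([k] ++ M :: l2) = cnt3 R123 l2 := by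
  rw [List.cons_append, List.nil_append, cnt3, cnt123_top h2, cnt2, cross_pair h1.le,
    List.countP_eq_zero.2, zero_add, zero_add]
  · intro b hb; have := h2 b hb; simp [R123]; omega
  · intro a b; simp [R123]; omega

theorem cross132 {k M : ℕ} {l2 : List ℕ} (h2 : ∀ b ∈ l2, b < M)
    (h1 : l2.countP (R12 k) = 1) :
    cnt3 R132 ([k] ++ M :: l2) = cnt3 R132 l2 + 1 := by
  rw [List.cons_append, List.nil_append, cnt3, cnt132_top h2, cnt2, cross_pair h1.le]
  · have : l2.countP (R132 k M) = l2.countP (R12 k) := by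
      apply List.countP_congr
      intro b hb; have := h2 b hb; simp [R132, R12, this]
    rw [this, h1]; ring
  · intro a b; simp [R132]; omega

/-! Lower bounds -/

theorem pair_sublist {a b : ℕ} {l : List ℕ} (hab : a ≠ b) (ha : a ∈ l) (hb : b ∈ l) :
    [a, b].Sublist l ∨ [b, a].Sublist l := by
  obtain ⟨s, t, rfl⟩ := List.append_of_mem ha
  simp only [List.mem_append, List.mem_cons] at hb
  rcases hb with hb | hb | hb
  · right
    exact (List.singleton_sublist.2 hb).append (List.singleton_sublist.2 (by simp) : [a].Sublist _)
  · exact absurd hb.symm hab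
  · left
    exact List.Sublist.trans ((List.singleton_sublist.2 hb).cons_cons a)
      (List.sublist_append_right _ _)

theorem lower_of_sublist {l l' : List ℕ} (h : l.Sublist l') (h2 : 2 ≤ cnt3 R132 l) :
    2 ≤ cnt3 R132 l' := h2.trans (cnt3_sublist _ h)

theorem lower_left {a c b M : ℕ} {l1 l2 : List ℕ} (ha : a ∈ l1) (hc : c ∈ l1) (hac : a ≠ c)
    (hb : b ∈ l2) (hbM : b < M) (hab : a < b) (hcb : c < b) :
    2 ≤ cnt3 R132 (l1 ++ M :: l2) := by
  rcases pair_sublist hac ha hc with h | h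
  · refine lower_of_sublist (h.append ((List.singleton_sublist.2 hb).cons_cons M)) ?_
    simp [cnt3, cnt2, List.countP_cons, R132, hab, hcb, hbM]
  · refine lower_of_sublist (h.append ((List.singleton_sublist.2 hb).cons_cons M)) ?_
    simp [cnt3, cnt2, List.countP_cons, R132, hab, hcb, hbM]

theorem lower_right {a c b M : ℕ} {l1 l2 : List ℕ} (ha : a ∈ l1) (hc : c ∈ l2) (hbc : b ≠ c)
    (hb : b ∈ l2) (hbM : b < M) (hcM : c < M) (hab : a < b) (hac : a < c) :
    2 ≤ cnt3 R132 (l1 ++ M :: l2) := by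
  rcases pair_sublist hbc hb hc with h | h
  · refine lower_of_sublist ((List.singleton_sublist.2 ha).append (h.cons_cons M)) ?_
    simp [cnt3, cnt2, List.countP_cons, R132, hab, hac, hbM, hcM]
    omega
  · refine lower_of_sublist ((List.singleton_sublist.2 ha).append (h.cons_cons M)) ?_
    simp [cnt3, cnt2, List.countP_cons, R132, hab, hac, hbM, hcM]
    omega

theorem lower_mid {k t b M : ℕ} {l l' l2 : List ℕ} (ht : t ∈ l') (hb : b ∈ l2)
    (hkb : k < b) (hbt : b < t) (hbM : b < M) :
    2 ≤ cnt3 R132 ((l ++ k :: l') ++ M :: l2) := by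
  refine lower_of_sublist (l := [k, t] ++ [M, b]) (List.Sublist.append ?_
    ((List.singleton_sublist.2 hb).cons_cons M)) ?_
  · exact List.Sublist.trans ((List.singleton_sublist.2 ht).cons_cons k)
      (List.sublist_append_right _ _)
  · simp [cnt3, cnt2, List.countP_cons, R132, hkb, hbt, hbM]
    omega

/-! ### Sums over all arrangements of a finite set -/

/-- All words using each element of `s` exactly once. -/
noncomputable def arr (s : Finset ℕ) : Finset (List ℕ) := s.toList.permutations.toFinset

theorem mem_arr {s : Finset ℕ} {l : List ℕ} : l ∈ arr s ↔ l.Nodup ∧ l.toFinset = s := by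
  rw [arr, List.mem_toFinset, List.mem_permutations]
  constructor
  · intro h
    refine ⟨h.nodup_iff.2 s.nodup_toList, ?_⟩
    rw [List.toFinset_eq_of_perm _ _ h, Finset.toList_toFinset]
  · rintro ⟨h, rfl⟩
    exact ((List.toFinset_toList h)).symm

theorem arr_mem {s : Finset ℕ} {l : List ℕ} (h : l ∈ arr s) {a : ℕ} : a ∈ l ↔ a ∈ s := by
  rw [← (mem_arr.1 h).2, List.mem_toFinset]

theorem arr_length {s : Finset ℕ} {l : List ℕ} (h : l ∈ arr s) : l.length = s.card := by
  rw [← (mem_arr.1 h).2, List.toFinset_card_of_nodup (mem_arr.1 h).1]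

theorem arr_empty : arr ∅ = {[]} := by
  ext l
  rw [mem_arr]
  constructor
  · rintro ⟨_, h⟩; simpa using h
  · intro h; simp at h; simp [h]

theorem sum_arr_image {R : Type*} [CommRing R] {f : ℕ → ℕ} (hf : StrictMono f) (s : Finset ℕ)
    (w : List ℕ → R) :
    ∑ l ∈ arr (s.image f), w l = ∑ l ∈ arr s, w (l.map f) := by
  symm
  refine Finset.sum_bij (fun l _ => l.map f) ?_ ?_ ?_ ?_
  · intro l hl
    rw [mem_arr] at hl ⊢
    refine ⟨hl.1.map hf.injective, ?_⟩
    rw [← hl.2]; ext a; simp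
  · intro l _ l' _ h
    exact List.map_injective_iff.2 hf.injective h
  · intro l hl
    rw [mem_arr] at hl
    have hr : ∀ a ∈ l, ∃ b ∈ s, f b = a := by
      intro a ha
      have : a ∈ s.image f := by rw [← hl.2]; simpa using ha
      simpa using this
    obtain ⟨l', rfl⟩ : ∃ l', List.map f l' = l := by
      have : l ∈ Set.range (List.map f) := by
        rw [Set.range_list_map]
        intro a ha
        obtain ⟨b, _, rfl⟩ := hr a ha
        simp
      exact this
    refine ⟨l', ?_, rfl⟩
    rw [mem_arr]
    refine ⟨hl.1.of_map f, ?_⟩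
    apply Finset.image_injective hf.injective
    rw [← hl.2]; ext a; simp
  · intro l _; rfl

theorem sum_arr_insert {R : Type*} [CommRing R] {M : ℕ} {s : Finset ℕ} (hM : M ∉ s)
    (w : List ℕ → R) :
    ∑ l ∈ arr (insert M s), w l =
      ∑ t ∈ s.powerset, ∑ l1 ∈ arr t, ∑ l2 ∈ arr (s \ t), w (l1 ++ M :: l2) := by
  have : ∀ t ∈ s.powerset, ∑ l1 ∈ arr t, ∑ l2 ∈ arr (s \ t), w (l1 ++ M :: l2) =
      ∑ p ∈ arr t ×ˢ arr (s \ t), w (p.1 ++ M :: p.2) := by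
    intro t _
    rw [Finset.sum_product]
  rw [Finset.sum_congr rfl this, Finset.sum_sigma']
  symm
  refine Finset.sum_bij (fun q _ => q.2.1 ++ M :: q.2.2) ?_ ?_ ?_ ?_
  · rintro ⟨t, l1, l2⟩ h
    simp only [Finset.mem_sigma, Finset.mem_powerset, Finset.mem_product] at h
    obtain ⟨ht, h1, h2⟩ := h
    have m1 := fun a => arr_mem h1 (a := a)
    have m2 := fun a => arr_mem h2 (a := a)
    rw [mem_arr]
    constructor
    · rw [List.nodup_append]
      refine ⟨(mem_arr.1 h1).1, ?_, ?_⟩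
      · rw [List.nodup_cons]
        refine ⟨?_, (mem_arr.1 h2).1⟩
        rw [m2]; simp [hM]
      · intro a ha b hb hab
        subst hab
        rw [m1] at ha
        rw [List.mem_cons, m2] at hb
        rcases hb with rfl | hb
        · exact hM (ht ha)
        · simp [ha] at hb
    · ext a
      simp only [List.mem_toFinset, List.mem_append, List.mem_cons, m1, m2, Finset.mem_sdiff,
        Finset.mem_insert]
      have := @ht a
      tauto
  · rintro ⟨t, l1, l2⟩ h ⟨t', l1', l2'⟩ h' he
    simp only [Finset.mem_sigma, Finset.mem_powerset, Finset.mem_product] at h h'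
    obtain ⟨ht, h1, h2⟩ := h
    obtain ⟨ht', h1', h2'⟩ := h'
    have n1 : M ∉ l1 := by rw [arr_mem h1]; exact fun h => hM (ht h)
    have n1' : M ∉ l1' := by rw [arr_mem h1']; exact fun h => hM (ht' h)
    have n2 : M ∉ l2 := by rw [arr_mem h2]; simp [hM]
    have n2' : M ∉ l2' := by rw [arr_mem h2']; simp [hM]
    have key : l1 = l1' ∧ l2 = l2' := by
      simp only at he
      rw [List.append_eq_append_iff] at he
      rcases he with ⟨u, e1, e2⟩ | ⟨u, e1, e2⟩
      · cases u with
        | nil => simp at e1 e2; exact ⟨e1.symm, e2⟩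
        | cons c u =>
          simp at e2
          exact absurd (by rw [e1, e2.1]; simp) n1'
      · cases u with
        | nil => simp at e1 e2; exact ⟨e1, e2.symm⟩
        | cons c u =>
          simp at e2
          exact absurd (by rw [e1, e2.1]; simp) n1
    obtain ⟨rfl, rfl⟩ := key
    have : t = t' := by rw [← (mem_arr.1 h1).2, ← (mem_arr.1 h1').2]
    subst this
    rfl
  · intro l hl
    have hMl : M ∈ l := by rw [arr_mem hl]; simp
    have hs := fun a => arr_mem hl (a := a)
    obtain ⟨l1, l2, rfl⟩ := List.append_of_mem hMl
    have hnd := (mem_arr.1 hl).1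
    rw [List.nodup_append, List.nodup_cons] at hnd
    obtain ⟨d1, ⟨d2, d3⟩, d4⟩ := hnd
    have n1 : M ∉ l1 := fun h => d4 M h M (by simp) rfl
    refine ⟨⟨l1.toFinset, l1, l2⟩, ?_, rfl⟩
    simp only [Finset.mem_sigma, Finset.mem_powerset, Finset.mem_product, mem_arr]
    refine ⟨?_, ⟨d1, trivial⟩, d3, ?_⟩
    · intro a ha
      rw [List.mem_toFinset] at ha
      have h1 : a ∈ insert M s := by rw [← hs]; simp [ha]
      rcases Finset.mem_insert.1 h1 with rfl | h1
      · exact absurd ha n1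
      · exact h1
    · ext a
      have h1 := hs a
      have h2 : a ∈ l1 → a ∉ l2 := fun h h' => d4 a h a (by simp [h']) rfl
      have h3 : a ∈ l2 → a ≠ M := fun h h' => d2 (h' ▸ h)
      have h4 : a ∈ s → a ≠ M := fun h h' => hM (h' ▸ h)
      simp only [List.mem_append, List.mem_cons, Finset.mem_insert] at h1
      simp only [List.mem_toFinset, Finset.mem_sdiff]
      tauto
  · rintro ⟨t, l1, l2⟩ _; rfl

/-! ### The weighted sums and their recursion -/

section weights
variable {R : Type*} [CommRing R]

/-- weight of a word -/
def wt (x y : R) (i : ℕ) (l : List ℕ) : R :=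
  x ^ cnt3 R132 l * y ^ (cnt3 R123 l + i * cnt2 R12 l + i.choose 2 * l.length)

/-- total weight of all arrangements of `0, …, n-1` -/
noncomputable def tot (x y : R) (i n : ℕ) : R := ∑ l ∈ arr (Finset.range n), wt x y i l

theorem wt_map (x y : R) (i : ℕ) {f : ℕ → ℕ} (hf : StrictMono f) (l : List ℕ) :
    wt x y i (l.map f) = wt x y i l := by
  simp only [wt, cnt12_map hf, cnt123_map hf, cnt132_map hf, List.length_map]

theorem sum_wt_image (x y : R) (i : ℕ) {f : ℕ → ℕ} (hf : StrictMono f) (n : ℕ) :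
    ∑ l ∈ arr ((Finset.range n).image f), wt x y i l = tot x y i n := by
  rw [sum_arr_image hf]; simp only [wt_map x y i hf]; rfl

theorem tot_zero (x y : R) (i : ℕ) : tot x y i 0 = 1 := by
  simp [tot, arr_empty, wt, cnt2, cnt3]

theorem wt_zero {x : R} (hx : x ^ 2 = 0) (y : R) (i : ℕ) {l : List ℕ} (h : 2 ≤ cnt3 R132 l) :
    wt x y i l = 0 := by
  rw [wt, pow_eq_zero_of_le h hx, zero_mul]

theorem choose_two_succ (i : ℕ) : (i + 1).choose 2 = i.choose 2 + i := by
  rw [Nat.choose_succ_succ' i 1, Nat.choose_one_right, add_comm]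

theorem wt_main (x y : R) (i : ℕ) {M : ℕ} {l1 l2 : List ℕ} (h1 : ∀ a ∈ l1, a < M)
    (h2 : ∀ b ∈ l2, b < M) (h12 : ∀ a ∈ l1, ∀ b ∈ l2, b < a) :
    wt x y i (l1 ++ M :: l2) = y ^ i.choose 2 * (wt x y (i + 1) l1 * wt x y i l2) := by
  have e1 := cnt12_app (k := []) h1 h12 (by simp)
  have e2 := cnt123_app (k := []) h1 h12 (by simp)
  have e3 := cnt132_app (k := []) h1 h12 (by simp)
  rw [List.nil_append] at e1 e2 e3
  rw [wt, e1, e2, e3, cnt12_top h2, cnt123_top h2, cnt132_top h2, wt, wt, choose_two_succ,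
    List.length_append, List.length_cons]
  ring

theorem wt_cross (x y : R) (i : ℕ) {k M : ℕ} {l l2 : List ℕ} (hk : k < M) (h1 : ∀ a ∈ l, a < M)
    (h2 : ∀ b ∈ l2, b < M) (h12 : ∀ a ∈ l, ∀ b ∈ l2, b < a) (hlk : ∀ a ∈ l, k < a)
    (hc : l2.countP (R12 k) = 1) :
    wt x y i ((l ++ [k]) ++ M :: l2) =
      x * y ^ (2 * i.choose 2 + 2 * i) * (wt x y (i + 1) l * wt x y i l2) := by
  have e1 := cnt12_app (k := [k]) h1 h12 (by simpa using hlk)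
  have e2 := cnt123_app (k := [k]) h1 h12 (by simpa using hlk)
  have e3 := cnt132_app (k := [k]) h1 h12 (by simpa using hlk)
  rw [cross12 hk h2 hc] at e1
  rw [cross123 h2 hc] at e2
  rw [cross132 h2 hc] at e3
  rw [List.append_assoc, wt, e1, e2, e3, wt, wt, choose_two_succ,
    List.length_append, List.length_append, List.length_cons, List.length_cons, List.length_nil]
  ring

/-- The contribution of the subset `t` of entries to the left of the maximum. -/
noncomputable def contr (x y : R) (i n : ℕ) (t : Finset ℕ) : R :=
  ∑ l1 ∈ arr t, ∑ l2 ∈ arr (Finset.range n \ t), wt x y i (l1 ++ n :: l2)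

theorem tot_succ (x y : R) (i n : ℕ) :
    tot x y i (n + 1) = ∑ t ∈ (Finset.range n).powerset, contr x y i n t := by
  rw [tot, Finset.range_add_one, sum_arr_insert (by simp)]
  rfl

theorem contr_main (x y : R) (i n k : ℕ) (hk : k ≤ n) :
    contr x y i n (Finset.Ico k n) =
      y ^ i.choose 2 * (tot x y (i + 1) (n - k) * tot x y i k) := by
  have e1 : Finset.Ico k n = (Finset.range (n - k)).image (fun a => a + k) := by
    ext a; simp only [Finset.mem_Ico, Finset.mem_image, Finset.mem_range]
    constructor
    · intro h; exact ⟨a - k, by omega, by omega⟩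
    · rintro ⟨b, hb, rfl⟩; omega
  have e2 : Finset.range n \ Finset.Ico k n = Finset.range k := by
    ext a; simp only [Finset.mem_sdiff, Finset.mem_Ico, Finset.mem_range]; omega
  have hf : StrictMono (fun a => a + k) := fun a b h => by simpa using h
  rw [← sum_wt_image x y (i + 1) hf (n - k), ← e1, tot, contr, e2, Finset.sum_mul_sum,
    Finset.mul_sum]
  refine Finset.sum_congr rfl fun l1 h1 => ?_
  rw [Finset.mul_sum]
  refine Finset.sum_congr rfl fun l2 h2 => ?_
  refine wt_main x y i ?_ ?_ ?_
  · intro a ha; rw [arr_mem h1, Finset.mem_Ico] at ha; omega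
  · intro a ha; rw [arr_mem h2, Finset.mem_range] at ha; omega
  · intro a ha b hb
    rw [arr_mem h1, Finset.mem_Ico] at ha
    rw [arr_mem h2, Finset.mem_range] at hb; omega

theorem contr_cross {x : R} (hx : x ^ 2 = 0) (y : R) (i n k : ℕ) (hk : k + 2 ≤ n) :
    contr x y i n (insert k (Finset.Ico (k + 2) n)) =
      x * y ^ (2 * i.choose 2 + 2 * i) * (tot x y (i + 1) (n - 2 - k) * tot x y i (k + 1)) := by
  have e1 : Finset.Ico (k + 2) n = (Finset.range (n - 2 - k)).image (fun a => a + (k + 2)) := by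
    ext a; simp only [Finset.mem_Ico, Finset.mem_image, Finset.mem_range]
    constructor
    · intro h; exact ⟨a - (k + 2), by omega, by omega⟩
    · rintro ⟨b, hb, rfl⟩; omega
  have e2 : Finset.range n \ insert k (Finset.Ico (k + 2) n) =
      (Finset.range (k + 1)).image (fun a => if a < k then a else a + 1) := by
    ext a
    simp only [Finset.mem_sdiff, Finset.mem_Ico, Finset.mem_range, Finset.mem_insert,
      Finset.mem_image]
    constructor
    · intro h
      by_cases ha : a < k
      · exact ⟨a, by omega, by simp [ha]⟩
      · refine ⟨k, by omega, ?_⟩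
        simp only [lt_irrefl, if_false]; omega
    · rintro ⟨b, hb, rfl⟩
      split_ifs <;> omega
  have hf : StrictMono (fun a => a + (k + 2)) := fun a b h => by simpa using h
  have hg : StrictMono (fun a => if a < k then a else a + 1) := fun a b h => by
    simp only; split_ifs <;> omega
  have hm : ∀ a, a ∈ Finset.range n \ insert k (Finset.Ico (k + 2) n) ↔ a < k ∨ a = k + 1 := by
    intro a
    simp only [Finset.mem_sdiff, Finset.mem_Ico, Finset.mem_range, Finset.mem_insert]
    omega
  rw [← sum_wt_image x y (i + 1) hf (n - 2 - k), ← e1, ← sum_wt_image x y i hg (k + 1), ← e2, contr,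
    sum_arr_insert (by simp)]
  rw [Finset.sum_eq_single (Finset.Ico (k + 2) n)]
  · rw [Finset.sum_mul_sum, Finset.mul_sum]
    refine Finset.sum_congr rfl fun l1 h1 => ?_
    rw [Finset.sdiff_self, arr_empty, Finset.sum_singleton, Finset.mul_sum]
    refine Finset.sum_congr rfl fun l2 h2 => ?_
    refine wt_cross x y i (by omega) ?_ ?_ ?_ ?_ ?_
    · intro a ha; rw [arr_mem h1, Finset.mem_Ico] at ha; omega
    · intro a ha; rw [arr_mem h2, hm] at ha; omega
    · intro a ha b hb
      rw [arr_mem h1, Finset.mem_Ico] at ha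
      rw [arr_mem h2, hm] at hb; omega
    · intro a ha; rw [arr_mem h1, Finset.mem_Ico] at ha; omega
    · have : l2.countP (R12 k) = l2.count (k + 1) := by
        rw [List.count]
        apply List.countP_congr
        intro b hb
        rw [arr_mem h2, hm] at hb
        simp [R12]; omega
      rw [this, List.count_eq_one_of_mem (mem_arr.1 h2).1]
      rw [arr_mem h2, hm]; simp
  · intro t ht hne
    rw [Finset.mem_powerset] at ht
    obtain ⟨c, hc⟩ : (Finset.Ico (k + 2) n \ t).Nonempty := by
      rw [Finset.nonempty_iff_ne_empty]
      intro h
      rw [Finset.sdiff_eq_empty_iff_subset] at h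
      exact hne (Finset.Subset.antisymm ht h)
    refine Finset.sum_eq_zero fun l h1 => Finset.sum_eq_zero fun l' h1' =>
      Finset.sum_eq_zero fun l2 h2 => wt_zero hx y i ?_
    refine lower_mid (t := c) (b := k + 1) ?_ ?_ ?_ ?_ ?_
    · rw [arr_mem h1']; exact hc
    · rw [arr_mem h2, hm]; simp
    · omega
    · have := Finset.mem_Ico.1 (Finset.mem_sdiff.1 hc).1; omega
    · omega
  · intro h; simp at h

/-- the two families of subsets that contribute -/
def famA (n : ℕ) : Finset (Finset ℕ) := (Finset.range (n + 1)).image (fun k => Finset.Ico k n)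
def famB (n : ℕ) : Finset (Finset ℕ) :=
  (Finset.range (n - 1)).image (fun k => insert k (Finset.Ico (k + 2) n))

theorem contr_zero {x : R} (hx : x ^ 2 = 0) (y : R) (i n : ℕ) (t : Finset ℕ)
    (ht : t ⊆ Finset.range n) (hA : t ∉ famA n) (hB : t ∉ famB n) : contr x y i n t = 0 := by
  have htn : ∀ a ∈ t, a < n := fun a ha => by simpa using ht ha
  have hne : t.Nonempty := by
    rw [Finset.nonempty_iff_ne_empty]
    rintro rfl
    exact hA (Finset.mem_image.2 ⟨n, by simp, by simp⟩)
  obtain ⟨a, ha, hmin⟩ : ∃ a ∈ t, ∀ c ∈ t, a ≤ c :=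
    ⟨t.min' hne, t.min'_mem hne, fun c hc => t.min'_le c hc⟩
  have han := htn a ha
  -- some element above `a` is missing
  obtain ⟨b, hb, hmax⟩ : ∃ b ∈ (Finset.Ico a n) \ t, ∀ c ∈ (Finset.Ico a n) \ t, c ≤ b := by
    have hne' : ((Finset.Ico a n) \ t).Nonempty := by
      rw [Finset.nonempty_iff_ne_empty]
      intro h
      rw [Finset.sdiff_eq_empty_iff_subset] at h
      refine hA (Finset.mem_image.2 ⟨a, by simp; omega, ?_⟩)
      refine Finset.Subset.antisymm h ?_
      intro c hc
      have := htn c hc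
      have := hmin c hc
      simp; omega
    exact ⟨_, Finset.max'_mem _ hne', fun c hc => Finset.le_max' _ c hc⟩
  simp only [Finset.mem_sdiff, Finset.mem_Ico] at hb hmax
  have hab : a < b := by
    rcases Nat.lt_or_ge a b with h | h
    · exact h
    · have : a = b := by omega
      subst this; exact absurd ha hb.2
  refine Finset.sum_eq_zero fun l1 h1 => Finset.sum_eq_zero fun l2 h2 => wt_zero hx y i ?_
  have m2 : ∀ c, c ∈ l2 ↔ c < n ∧ c ∉ t := by
    intro c; rw [arr_mem h2]; simp
  by_cases hb1 : b = a + 1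
  · exfalso
    subst hb1
    refine hB (Finset.mem_image.2 ⟨a, by simp; omega, ?_⟩)
    ext c
    simp only [Finset.mem_insert, Finset.mem_Ico]
    constructor
    · rintro (rfl | h)
      · exact ha
      · by_contra hc
        have := hmax c ⟨by omega, hc⟩
        omega
    · intro hc
      have h3 := htn c hc
      have h4 := hmin c hc
      have : c ≠ a + 1 := fun h => hb.2 (h ▸ hc)
      omega
  · by_cases hc : a + 1 ∈ t
    · exact lower_left (a := a) (c := a + 1) (b := b) ((arr_mem h1).2 ha) ((arr_mem h1).2 hc)
        (by omega) ((m2 b).2 ⟨by omega, hb.2⟩) (by omega) (by omega) (by omega)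
    · exact lower_right (a := a) (c := a + 1) (b := b) ((arr_mem h1).2 ha)
        ((m2 _).2 ⟨by omega, hc⟩) hb1 ((m2 b).2 ⟨by omega, hb.2⟩) (by omega) (by omega)
        (by omega) (by omega)

theorem tot_rec {x : R} (hx : x ^ 2 = 0) (y : R) (i n : ℕ) :
    tot x y i (n + 1) =
      ∑ k ∈ Finset.range (n + 1), y ^ i.choose 2 * (tot x y (i + 1) (n - k) * tot x y i k) +
      ∑ k ∈ Finset.range (n - 1),
        x * y ^ (2 * i.choose 2 + 2 * i) * (tot x y (i + 1) (n - 2 - k) * tot x y i (k + 1)) := by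
  have hsub : famA n ∪ famB n ⊆ (Finset.range n).powerset := by
    intro t ht
    rw [Finset.mem_powerset]
    rcases Finset.mem_union.1 ht with h | h
    · obtain ⟨k, _, rfl⟩ := Finset.mem_image.1 h
      intro a ha; simp at ha ⊢; omega
    · obtain ⟨k, hk, rfl⟩ := Finset.mem_image.1 h
      intro a ha; simp at ha hk ⊢; omega
  have hdisj : Disjoint (famA n) (famB n) := by
    rw [Finset.disjoint_left]
    intro t h h'
    obtain ⟨k, hk, rfl⟩ := Finset.mem_image.1 h
    obtain ⟨j, hj, he⟩ := Finset.mem_image.1 h'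
    have h1 := Finset.ext_iff.1 he j
    have h2 := Finset.ext_iff.1 he (j + 1)
    simp at h1 h2 hj
    omega
  rw [tot_succ, ← Finset.sum_subset hsub, Finset.sum_union hdisj]
  · congr 1
    · rw [famA, Finset.sum_image]
      · refine Finset.sum_congr rfl fun k hk => contr_main x y i n k ?_
        simp at hk; omega
      · intro k hk j hj he
        simp at hk hj
        have h1 := Finset.ext_iff.1 he j
        have h2 := Finset.ext_iff.1 he k
        simp at h1 h2
        omega
    · rw [famB, Finset.sum_image]
      · refine Finset.sum_congr rfl fun k hk => contr_cross hx y i n k ?_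
        simp at hk; omega
      · intro k hk j hj he
        simp at hk hj
        have h1 := Finset.ext_iff.1 he j
        have h2 := Finset.ext_iff.1 he k
        simp at h1 h2
        omega
  · intro t ht hn
    rw [Finset.mem_union, not_or] at hn
    exact contr_zero hx y i n t (Finset.mem_powerset.1 ht) hn.1 hn.2

/-- The generating function. -/
noncomputable def gf (x y : R) (i : ℕ) : PowerSeries R := PowerSeries.mk (tot x y i)

theorem gf_rec {x : R} (hx : x ^ 2 = 0) (y : R) (i : ℕ) :
    gf x y i = 1 + PowerSeries.X * PowerSeries.C y ^ i.choose 2 * gf x y (i + 1) * gf x y i +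
      PowerSeries.C x * PowerSeries.X ^ 2 * PowerSeries.C y ^ (2 * i.choose 2 + 2 * i) *
        gf x y (i + 1) * (gf x y i - 1) := by
  have hs : gf x y i - 1 = PowerSeries.X * PowerSeries.mk (fun k => tot x y i (k + 1)) := by
    ext n
    cases n with
    | zero => simp [gf, tot_zero]
    | succ n => simp [gf, PowerSeries.coeff_succ_X_mul, PowerSeries.coeff_one]
  rw [hs]
  have hr : 1 + PowerSeries.X * PowerSeries.C y ^ i.choose 2 * gf x y (i + 1) * gf x y i +
      PowerSeries.C x * PowerSeries.X ^ 2 * PowerSeries.C y ^ (2 * i.choose 2 + 2 * i) *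
        gf x y (i + 1) * (PowerSeries.X * PowerSeries.mk (fun k => tot x y i (k + 1))) =
     1 + PowerSeries.X * (PowerSeries.C (y ^ i.choose 2) * (gf x y i * gf x y (i + 1)) +
       PowerSeries.X ^ 2 * (PowerSeries.C (x * y ^ (2 * i.choose 2 + 2 * i)) * 
         (PowerSeries.mk (fun k => tot x y i (k + 1)) * gf x y (i + 1)))) := by
    simp only [map_mul, map_pow]; ring
  rw [hr]
  ext n
  cases n with
  | zero => simp [gf, tot_zero]
  | succ n =>
    rw [map_add, PowerSeries.coeff_succ_X_mul, map_add, PowerSeries.coeff_C_mul]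
    rw [show PowerSeries.coeff (n + 1) (gf x y i) = tot x y i (n + 1) by simp [gf], tot_rec hx]
    rw [PowerSeries.coeff_one, if_neg (by omega), zero_add]
    congr 1
    · rw [PowerSeries.coeff_mul, Finset.Nat.sum_antidiagonal_eq_sum_range_succ_mk, Finset.mul_sum]
      refine Finset.sum_congr rfl fun k hk => ?_
      simp [gf]; ring
    · rw [PowerSeries.coeff_X_pow_mul']
      split_ifs with h
      · rw [PowerSeries.coeff_C_mul, PowerSeries.coeff_mul,
          Finset.Nat.sum_antidiagonal_eq_sum_range_succ_mk, Finset.mul_sum]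
        rw [show n - 1 = (n - 2).succ by omega]
        refine Finset.sum_congr rfl fun k hk => ?_
        simp [gf]; ring
      · rw [show n - 1 = 0 by omega]; simp

end weights

/-! ### Solving the system modulo `x ^ 2` and `y ^ 5` -/

theorem solve_H2 {S : Type*} [CommRing S] (z x y H2 H3 H4 H5 : S) (hy : y ^ 5 = 0)
    (e4 : H4 = 1 + z * y ^ 6 * H5 * H4 + x * z ^ 2 * y ^ 20 * H5 * (H4 - 1))
    (e3 : H3 = 1 + z * y ^ 3 * H4 * H3 + x * z ^ 2 * y ^ 12 * H4 * (H3 - 1))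
    (e2 : H2 = 1 + z * y ^ 1 * H3 * H2 + x * z ^ 2 * y ^ 6 * H3 * (H2 - 1)) :
    H2 = 1 + z*y + z^2*y^2 + z^3*y^3 + (z^4 + z^2)*y^4 := by
  have y6 : y ^ 6 = 0 := pow_eq_zero_of_le (by norm_num) hy
  have y12 : y ^ 12 = 0 := pow_eq_zero_of_le (by norm_num) hy
  have y20 : y ^ 20 = 0 := pow_eq_zero_of_le (by norm_num) hy
  have f4 : H4 = 1 := by rw [e4, y6, y20]; ring
  have f3 : H3 = 1 + z * y ^ 3 := by
    rw [f4, y12] at e3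
    linear_combination (1 + z * y ^ 3) * e3 + z ^ 2 * y * H3 * hy
  rw [f3, y6] at e2
  have g2 : H2 = 1 + (z * y + z ^ 2 * y ^ 4) * H2 := by linear_combination e2
  have g5 : (z * y + z ^ 2 * y ^ 4) ^ 5 = 0 := by
    rw [show z * y + z ^ 2 * y ^ 4 = y * (z + z ^ 2 * y ^ 3) by ring, mul_pow, hy, zero_mul]
  generalize hc : z * y + z ^ 2 * y ^ 4 = c at g2 g5
  have g : H2 = 1 + c + c ^ 2 + c ^ 3 + c ^ 4 := by
    linear_combination (1 + c + c ^ 2 + c ^ 3 + c ^ 4) * g2 + H2 * g5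
  rw [g, ← hc]
  linear_combination (2*z^3 + z^4*y^3 + (3*z^4 + 3*z^5*y^3 + z^6*y^6)*y +
    (4*z^5 + 6*z^6*y^3 + 4*z^7*y^6 + z^8*y^9)*y^2) * hy

theorem solve_system {S : Type*} [CommRing S] (z x y H0 H1 H2 H3 H4 H5 : S)
    (hz : ∀ s, IsUnit (1 - z * s)) (hx : x ^ 2 = 0) (hy : y ^ 5 = 0)
    (e4 : H4 = 1 + z * y ^ 6 * H5 * H4 + x * z ^ 2 * y ^ 20 * H5 * (H4 - 1))
    (e3 : H3 = 1 + z * y ^ 3 * H4 * H3 + x * z ^ 2 * y ^ 12 * H4 * (H3 - 1))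
    (e2 : H2 = 1 + z * y ^ 1 * H3 * H2 + x * z ^ 2 * y ^ 6 * H3 * (H2 - 1))
    (e1 : H1 = 1 + z * y ^ 0 * H2 * H1 + x * z ^ 2 * y ^ 2 * H2 * (H1 - 1))
    (e0 : H0 = 1 + z * y ^ 0 * H1 * H0 + x * z ^ 2 * y ^ 0 * H1 * (H0 - 1)) :
    (1 - 2 * z) ^ 6 * H0 =
      ((1) + (-11)*z + (50)*z^2 + (-120)*z^3 + (160)*z^4 + (-112)*z^5 + (32)*z^6) + ((1)*z^3 +
      (-8)*z^4 + (24)*z^5 + (-32)*z^6 + (16)*z^7)*y + ((1)*z^4 + (-7)*z^5 + (18)*z^6 + (-20)*z^7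
      + (8)*z^8)*y^2 + ((1)*z^5 + (-6)*z^6 + (13)*z^7 + (-12)*z^8 + (4)*z^9)*y^3 + ((1)*z^4 +
      (-8)*z^5 + (25)*z^6 + (-37)*z^7 + (25)*z^8 + (-7)*z^9 + (2)*z^10)*y^4 + ((1)*z^3 +
      (-8)*z^4 + (24)*z^5 + (-32)*z^6 + (16)*z^7)*x + ((2)*z^5 + (-12)*z^6 + (24)*z^7 +
      (-16)*z^8)*x*y + ((1)*z^4 + (-8)*z^5 + (26)*z^6 + (-41)*z^7 + (28)*z^8 + (-4)*z^9)*x*y^2 +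
      ((2)*z^5 + (-14)*z^6 + (38)*z^7 + (-46)*z^8 + (20)*z^9)*x*y^3 + ((5)*z^6 + (-30)*z^7 +
      (65)*z^8 + (-55)*z^9 + (12)*z^10 + (1)*z^11)*x*y^4 := by
  have f2 := solve_H2 z x y H2 H3 H4 H5 hy e4 e3 e2
  have f1 : (1 - z) ^ 5 * H1 =
      ((1) + (-4)*z + (6)*z^2 + (-4)*z^3 + (1)*z^4) + ((1)*z^2 + (-3)*z^3 + (3)*z^4 +
      (-1)*z^5)*y + ((1)*z^3 + (-2)*z^4 + (1)*z^5)*y^2 + ((1)*z^4 + (-1)*z^5)*y^3 + ((1)*z^3 +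
      (-3)*z^4 + (4)*z^5 + (-1)*z^6)*y^4 + ((1)*z^3 + (-3)*z^4 + (3)*z^5 + (-1)*z^6)*x*y^2 +
      ((2)*z^4 + (-4)*z^5 + (2)*z^6)*x*y^3 + ((3)*z^5 + (-3)*z^6)*x*y^4 := by
    apply (hz (H2 + x * z * y ^ 2 * H2)).mul_left_cancel
    rw [f2] at e1 ⊢
    linear_combination (1 - z) ^ 5 * e1 - (
      (-1)*z^5*y^4 + (3)*z^6*y^4 + (-3)*z^7*y^4 + (1)*z^8*y^4 + (-3)*z^6*y^5 + (7)*z^7*y^5 +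
      (-5)*z^8*y^5 + (1)*z^9*y^5 + (-6)*z^7*y^6 + (10)*z^8*y^6 + (-5)*z^9*y^6 + (1)*z^10*y^6 +
      (-6)*z^8*y^7 + (10)*z^9*y^7 + (-5)*z^10*y^7 + (1)*z^11*y^7 + (-1)*z^7*y^8 + (3)*z^8*y^8 +
      (-9)*z^9*y^8 + (11)*z^10*y^8 + (-5)*z^11*y^8 + (1)*z^12*y^8 + (-2)*z^8*y^9 + (4)*z^9*y^9 +
      (-7)*z^10*y^9 + (7)*z^11*y^9 + (-2)*z^12*y^9 + (-3)*z^9*y^10 + (3)*z^10*y^10 +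
      (-3)*z^11*y^10 + (3)*z^12*y^10) * hx - (
      (-2)*z^5 + (6)*z^6 + (-10)*z^7 + (8)*z^8 + (-4)*z^9 + (1)*z^10 + (-2)*z^6*y + (5)*z^7*y +
      (-7)*z^8*y + (4)*z^9*y + (-1)*z^10*y + (-2)*z^7*y^2 + (4)*z^8*y^2 + (-5)*z^9*y^2 +
      (2)*z^10*y^2 + (-1)*z^6*y^3 + (3)*z^7*y^3 + (-5)*z^8*y^3 + (4)*z^9*y^3 + (-4)*z^10*y^3 +
      (1)*z^11*y^3 + (-4)*z^6*x + (4)*z^7*x + (-2)*z^5*x*y + (6)*z^6*x*y + (-11)*z^7*x*y +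
      (6)*z^8*x*y + (-2)*z^6*x*y^2 + (4)*z^7*x*y^2 + (-6)*z^8*x*y^2 + (1)*z^9*x*y^2 +
      (3)*z^10*x*y^2 + (-1)*z^11*x*y^2 + (-2)*z^7*x*y^3 + (2)*z^8*x*y^3 + (-4)*z^9*x*y^3 +
      (1)*z^10*x*y^3 + (2)*z^11*x*y^3 + (-2)*z^8*x*y^4 + (4)*z^9*x*y^4 + (-5)*z^10*x*y^4 +
      (2)*z^11*x*y^4 + (-1)*z^7*x*y^5 + (3)*z^8*x*y^5 + (-5)*z^9*x*y^5 + (4)*z^10*x*y^5 +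
      (-4)*z^11*x*y^5 + (1)*z^12*x*y^5) * hy
  have uA : IsUnit ((1 - z) ^ 5) := by
    have := hz 1
    rw [mul_one] at this
    exact this.pow 5
  apply uA.mul_left_cancel
  apply (hz (H1 + x * z * H1)).mul_left_cancel
  generalize hN : (1 - z) ^ 5 * H1 = N at f1
  have k1 : (1 - z * (H1 + x * z * H1)) * ((1 - z) ^ 5 * ((1 - 2 * z) ^ 6 * H0)) =
      (1 - 2 * z) ^ 6 * ((1 - z) ^ 5 - x * z ^ 2 * N) := by
    rw [← hN]
    linear_combination (1 - z) ^ 5 * (1 - 2 * z) ^ 6 * e0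
  have k2 : ∀ T, (1 - z * (H1 + x * z * H1)) * ((1 - z) ^ 5 * T) =
      T * ((1 - z) ^ 5 - (z + x * z ^ 2) * N) := by
    intro T
    rw [← hN]
    ring
  rw [k1, k2, f1]
  linear_combination (-1) * (
      (-1)*z^5 + (12)*z^6 + (-62)*z^7 + (180)*z^8 + (-321)*z^9 + (360)*z^10 + (-248)*z^11 +
      (96)*z^12 + (-16)*z^13 + (-3)*z^7*y + (31)*z^8*y + (-135)*z^9*y + (321)*z^10*y +
      (-450)*z^11*y + (372)*z^12*y + (-168)*z^13*y + (32)*z^14*y + (-2)*z^6*y^2 + (24)*z^7*y^2 +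
      (-127)*z^8*y^2 + (385)*z^9*y^2 + (-725)*z^10*y^2 + (856)*z^11*y^2 + (-600)*z^12*y^2 +
      (205)*z^13*y^2 + (-4)*z^14*y^2 + (-12)*z^15*y^2 + (-4)*z^7*y^3 + (42)*z^8*y^3 +
      (-189)*z^9*y^3 + (469)*z^10*y^3 + (-683)*z^11*y^3 + (561)*z^12*y^3 + (-201)*z^13*y^3 +
      (-27)*z^14*y^3 + (36)*z^15*y^3 + (-4)*z^16*y^3 + (-10)*z^8*y^4 + (96)*z^9*y^4 +
      (-387)*z^10*y^4 + (837)*z^11*y^4 + (-1021)*z^12*y^4 + (653)*z^13*y^4 + (-139)*z^14*y^4 +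
      (-49)*z^15*y^4 + (20)*z^16*y^4 + (-1)*z^17*y^4 + (-4)*z^9*y^5 + (24)*z^10*y^5 +
      (-34)*z^11*y^5 + (-88)*z^12*y^5 + (384)*z^13*y^5 + (-580)*z^14*y^5 + (426)*z^15*y^5 +
      (-140)*z^16*y^5 + (13)*z^17*y^5 + (1)*z^18*y^5 + (-2)*z^9*y^6 + (10)*z^10*y^6 +
      (-10)*z^11*y^6 + (-23)*z^12*y^6 + (27)*z^13*y^6 + (88)*z^14*y^6 + (-186)*z^15*y^6 +
      (118)*z^16*y^6 + (-26)*z^17*y^6 + (2)*z^18*y^6 + (-4)*z^10*y^7 + (24)*z^11*y^7 +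
      (-52)*z^12*y^7 + (48)*z^13*y^7 + (-42)*z^14*y^7 + (93)*z^15*y^7 + (-107)*z^16*y^7 +
      (45)*z^17*y^7 + (-5)*z^18*y^7 + (-8)*z^11*y^8 + (57)*z^12*y^8 + (-169)*z^13*y^8 +
      (276)*z^14*y^8 + (-293)*z^15*y^8 + (215)*z^16*y^8 + (-94)*z^17*y^8 + (17)*z^18*y^8 +
      (1)*z^19*y^8 + (-1)*z^8*x*y^2 + (11)*z^9*x*y^2 + (-51)*z^10*x*y^2 + (129)*z^11*x*y^2 +
      (-192)*z^12*x*y^2 + (168)*z^13*x*y^2 + (-80)*z^14*x*y^2 + (16)*z^15*x*y^2 + (-2)*z^9*x*y^3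
      + (18)*z^10*x*y^3 + (-64)*z^11*x*y^3 + (110)*z^12*x*y^3 + (-82)*z^13*x*y^3 +
      (-4)*z^14*x*y^3 + (40)*z^15*x*y^3 + (-16)*z^16*x*y^3 + (-1)*z^9*x*y^4 + (8)*z^10*x*y^4 +
      (-30)*z^11*x*y^4 + (80)*z^12*x*y^4 + (-169)*z^13*x*y^4 + (245)*z^14*x*y^4 +
      (-201)*z^15*x*y^4 + (72)*z^16*x*y^4 + (-4)*z^17*x*y^4 + (-4)*z^10*x*y^5 + (40)*z^11*x*y^5
      + (-178)*z^12*x*y^5 + (448)*z^13*x*y^5 + (-666)*z^14*x*y^5 + (558)*z^15*x*y^5 +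
      (-226)*z^16*x*y^5 + (28)*z^17*x*y^5 + (-12)*z^11*x*y^6 + (108)*z^12*x*y^6 +
      (-408)*z^13*x*y^6 + (818)*z^14*x*y^6 + (-909)*z^15*x*y^6 + (533)*z^16*x*y^6 +
      (-140)*z^17*x*y^6 + (9)*z^18*x*y^6 + (1)*z^19*x*y^6 + (-16)*z^12*x*y^7 + (128)*z^13*x*y^7
      + (-416)*z^14*x*y^7 + (682)*z^15*x*y^7 + (-572)*z^16*x*y^7 + (216)*z^17*x*y^7 +
      (-20)*z^18*x*y^7 + (-2)*z^19*x*y^7 + (-15)*z^13*x*y^8 + (105)*z^14*x*y^8 +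
      (-285)*z^15*x*y^8 + (360)*z^16*x*y^8 + (-201)*z^17*x*y^8 + (33)*z^18*x*y^8 +
      (3)*z^19*x*y^8) * hx - (
      (-2)*z^7 + (22)*z^8 + (-106)*z^9 + (290)*z^10 + (-486)*z^11 + (500)*z^12 + (-300)*z^13 +
      (96)*z^14 + (-17)*z^15 + (2)*z^16 + (-2)*z^8*y + (20)*z^9*y + (-86)*z^10*y + (205)*z^11*y
      + (-290)*z^12*y + (241)*z^13*y + (-109)*z^14*y + (23)*z^15*y + (-2)*z^16*y + (-2)*z^9*y^2
      + (18)*z^10*y^2 + (-68)*z^11*y^2 + (138)*z^12*y^2 + (-160)*z^13*y^2 + (105)*z^14*y^2 +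
      (-37)*z^15*y^2 + (6)*z^16*y^2 + (-1)*z^8*y^3 + (11)*z^9*y^3 + (-53)*z^10*y^3 +
      (145)*z^11*y^3 + (-244)*z^12*y^3 + (255)*z^13*y^3 + (-160)*z^14*y^3 + (59)*z^15*y^3 +
      (-15)*z^16*y^3 + (2)*z^17*y^3 + (-2)*z^8*x + (6)*z^9*x + (38)*z^10*x + (-246)*z^11*x +
      (564)*z^12*x + (-638)*z^13*x + (352)*z^14*x + (-72)*z^15*x + (-4)*z^16*x + (3)*z^17*x +
      (-2)*z^8*x*y + (20)*z^9*x*y + (-98)*z^10*x*y + (299)*z^11*x*y + (-586)*z^12*x*y +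
      (707)*z^13*x*y + (-478)*z^14*x*y + (149)*z^15*x*y + (-12)*z^16*x*y + (-1)*z^17*x*y +
      (-4)*z^9*x*y^2 + (38)*z^10*x*y^2 + (-162)*z^11*x*y^2 + (396)*z^12*x*y^2 +
      (-586)*z^13*x*y^2 + (505)*z^14*x*y^2 + (-218)*z^15*x*y^2 + (28)*z^16*x*y^2 +
      (3)*z^17*x*y^2 + (-1)*z^9*x*y^3 + (3)*z^10*x*y^3 + (19)*z^11*x*y^3 + (-129)*z^12*x*y^3 +
      (317)*z^13*x*y^3 + (-398)*z^14*x*y^3 + (256)*z^15*x*y^3 + (-68)*z^16*x*y^3 +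
      (-1)*z^17*x*y^3 + (3)*z^18*x*y^3) * hy

/-! ### From permutations to words -/

theorem countP_ofFn (R : ℕ → Bool) {n : ℕ} (f : Fin n → ℕ) :
    (List.ofFn f).countP R = ∑ i, if R (f i) then 1 else 0 := by
  induction n with
  | zero => simp
  | succ n ih => rw [List.ofFn_succ, List.countP_cons, ih, Fin.sum_univ_succ, add_comm]

theorem cnt2_ofFn (R : ℕ → ℕ → Bool) {n : ℕ} (f : Fin n → ℕ) :
    cnt2 R (List.ofFn f) = ∑ i, ∑ j, if i < j ∧ R (f i) (f j) then 1 else 0 := by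
  induction n with
  | zero => simp [cnt2]
  | succ n ih =>
    rw [List.ofFn_succ, cnt2, ih, Fin.sum_univ_succ, countP_ofFn, Fin.sum_univ_succ]
    simp only [Fin.sum_univ_succ (n := n), Fin.succ_lt_succ_iff, Fin.not_lt_zero, false_and,
      if_false, zero_add, Fin.succ_pos, true_and]

theorem cnt3_ofFn (R : ℕ → ℕ → ℕ → Bool) {n : ℕ} (f : Fin n → ℕ) :
    cnt3 R (List.ofFn f) =
      ∑ i, ∑ j, ∑ k, if i < j ∧ j < k ∧ R (f i) (f j) (f k) then 1 else 0 := by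
  induction n with
  | zero => simp [cnt3]
  | succ n ih =>
    rw [List.ofFn_succ, cnt3, ih, cnt2_ofFn]
    simp only [Fin.sum_univ_succ (n := n), Fin.succ_lt_succ_iff, Fin.not_lt_zero, false_and,
      and_false, if_false, zero_add, Fin.succ_pos, true_and, Finset.sum_const_zero]

/-- the word of a permutation -/
def word {n : ℕ} (π : Equiv.Perm (Fin n)) : List ℕ := List.ofFn (fun i => (π i : ℕ))

theorem count132_word {n : ℕ} (π : Equiv.Perm (Fin n)) : count132 π = cnt3 R132 (word π) := by
  rw [word, cnt3_ofFn, count132, Finset.card_filter, Fintype.sum_prod_type]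
  refine Finset.sum_congr rfl fun i _ => ?_
  rw [Fintype.sum_prod_type]
  refine Finset.sum_congr rfl fun j _ => Finset.sum_congr rfl fun k _ => ?_
  simp [R132]

theorem count123_word {n : ℕ} (π : Equiv.Perm (Fin n)) : count123 π = cnt3 R123 (word π) := by
  rw [word, cnt3_ofFn, count123, Finset.card_filter, Fintype.sum_prod_type]
  refine Finset.sum_congr rfl fun i _ => ?_
  rw [Fintype.sum_prod_type]
  refine Finset.sum_congr rfl fun j _ => Finset.sum_congr rfl fun k _ => ?_
  simp [R123]

theorem sum_word {R : Type*} [CommRing R] (n : ℕ) (w : List ℕ → R) :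
    ∑ π : Equiv.Perm (Fin n), w (word π) = ∑ l ∈ arr (Finset.range n), w l := by
  refine Finset.sum_bij (fun π _ => word π) ?_ ?_ ?_ ?_
  · intro π _
    rw [mem_arr]
    constructor
    · rw [word, List.nodup_ofFn]
      exact Fin.val_injective.comp π.injective
    · ext a
      simp only [word, List.mem_toFinset, List.mem_ofFn, Finset.mem_range]
      constructor
      · rintro ⟨i, rfl⟩; exact (π i).2
      · intro h; exact ⟨π.symm ⟨a, h⟩, by simp⟩
  · intro π _ σ _ h
    have := List.ofFn_injective h
    ext i
    exact congrFun this i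
  · intro l hl
    have hlen : l.length = n := by rw [arr_length hl, Finset.card_range]
    subst hlen
    have hlt : ∀ i : Fin l.length, l.get i < l.length := by
      intro i
      have := (arr_mem hl).1 (l.get_mem i)
      simpa using this
    have hinj : Function.Injective (fun i : Fin l.length => (⟨l.get i, hlt i⟩ : Fin l.length)) := by
      intro i j h
      exact (mem_arr.1 hl).1.injective_get (by simpa using h)
    refine ⟨Equiv.ofBijective _ (Finite.injective_iff_bijective.1 hinj), Finset.mem_univ _, ?_⟩
    simp [word]
  · intro π _; rfl

/-! ### Extraction of the coefficient -/

abbrev DR := DualNumber (Polynomial ℚ)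

noncomputable def xR : DR := DualNumber.eps
noncomputable def yR : DR := TrivSqZeroExt.inl Polynomial.X

/-- coefficient of `x y ^ 4` -/
noncomputable def phi : DR →ₗ[ℚ] ℚ :=
  (Polynomial.lcoeff ℚ 4).comp ((TrivSqZeroExt.sndHom (Polynomial ℚ) (Polynomial ℚ)).restrictScalars ℚ)

theorem xR_sq : xR ^ 2 = 0 := by rw [pow_two]; exact DualNumber.eps_mul_eps

theorem phi_apply (r : DR) : phi r = (TrivSqZeroExt.snd r).coeff 4 := rfl

theorem phi_y (b : ℕ) : phi (yR ^ b) = 0 := by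
  rw [phi_apply, yR, TrivSqZeroExt.inl_pow]; simp

theorem phi_xy (b : ℕ) : phi (xR * yR ^ b) = if b = 4 then 1 else 0 := by
  rw [phi_apply, yR, xR, TrivSqZeroExt.inl_pow, DualNumber.eps, TrivSqZeroExt.snd_mul]
  simp [Polynomial.coeff_X_pow, eq_comm]

theorem phi_y5 (r : DR) : phi (yR ^ 5 * r) = 0 := by
  rw [phi_apply, yR, TrivSqZeroExt.inl_pow, TrivSqZeroExt.snd_mul]
  simp [Polynomial.coeff_X_pow_mul']

theorem phi_mon (a b : ℕ) : phi (xR ^ a * yR ^ b) = if a = 1 ∧ b = 4 then 1 else 0 := by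
  rcases a with _ | _ | a
  · simp [phi_y]
  · simp [phi_xy]
  · rw [pow_eq_zero_of_le (by omega) xR_sq]; simp

noncomputable def Phi (s : PowerSeries DR) : PowerSeries ℚ :=
  PowerSeries.mk fun n => phi (PowerSeries.coeff n s)

theorem Phi_add (s t : PowerSeries DR) : Phi (s + t) = Phi s + Phi t := by
  ext n; simp [Phi]

theorem Phi_map_mul (q : PowerSeries ℚ) (s : PowerSeries DR) :
    Phi (PowerSeries.map (algebraMap ℚ DR) q * s) = q * Phi s := by
  ext n
  simp only [Phi, PowerSeries.coeff_mk, PowerSeries.coeff_mul, map_sum, PowerSeries.coeff_map]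
  refine Finset.sum_congr rfl fun p _ => ?_
  rw [← Algebra.smul_def, map_smul, smul_eq_mul]

theorem Phi_C (r : DR) : Phi (PowerSeries.C r) = PowerSeries.C (phi r) := by
  ext n
  simp only [Phi, PowerSeries.coeff_mk, PowerSeries.coeff_C]
  split_ifs <;> simp

theorem Phi_gf : Phi (gf xR yR 0) = PowerSeries.mk (fun n => (B n : ℚ)) := by
  ext n
  rw [Phi, PowerSeries.coeff_mk, gf, PowerSeries.coeff_mk, PowerSeries.coeff_mk, tot, map_sum]
  have : ∀ l : List ℕ, phi (wt xR yR 0 l) =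
      if cnt3 R132 l = 1 ∧ cnt3 R123 l = 4 then (1 : ℚ) else 0 := by
    intro l
    rw [← phi_mon, wt]; simp
  simp only [this]
  rw [← sum_word n (fun l => if cnt3 R132 l = 1 ∧ cnt3 R123 l = 4 then (1 : ℚ) else 0), B,
    Finset.card_filter]
  push_cast
  simp only [count132_word, count123_word]

/-! ### Conclusion -/

noncomputable def q00 : PowerSeries ℚ :=
  (1) * PowerSeries.X ^ 0 + (-11) * PowerSeries.X ^ 1 + (50) * PowerSeries.X ^ 2 + (-120) *
  PowerSeries.X ^ 3 + (160) * PowerSeries.X ^ 4 + (-112) * PowerSeries.X ^ 5 + (32) *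
  PowerSeries.X ^ 6
noncomputable def q01 : PowerSeries ℚ :=
  (1) * PowerSeries.X ^ 3 + (-8) * PowerSeries.X ^ 4 + (24) * PowerSeries.X ^ 5 + (-32) *
  PowerSeries.X ^ 6 + (16) * PowerSeries.X ^ 7
noncomputable def q02 : PowerSeries ℚ :=
  (1) * PowerSeries.X ^ 4 + (-7) * PowerSeries.X ^ 5 + (18) * PowerSeries.X ^ 6 + (-20) *
  PowerSeries.X ^ 7 + (8) * PowerSeries.X ^ 8
noncomputable def q03 : PowerSeries ℚ :=
  (1) * PowerSeries.X ^ 5 + (-6) * PowerSeries.X ^ 6 + (13) * PowerSeries.X ^ 7 + (-12) *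
  PowerSeries.X ^ 8 + (4) * PowerSeries.X ^ 9
noncomputable def q04 : PowerSeries ℚ :=
  (1) * PowerSeries.X ^ 4 + (-8) * PowerSeries.X ^ 5 + (25) * PowerSeries.X ^ 6 + (-37) *
  PowerSeries.X ^ 7 + (25) * PowerSeries.X ^ 8 + (-7) * PowerSeries.X ^ 9 + (2) * PowerSeries.X
  ^ 10
noncomputable def q10 : PowerSeries ℚ :=
  (1) * PowerSeries.X ^ 3 + (-8) * PowerSeries.X ^ 4 + (24) * PowerSeries.X ^ 5 + (-32) *
  PowerSeries.X ^ 6 + (16) * PowerSeries.X ^ 7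
noncomputable def q11 : PowerSeries ℚ :=
  (2) * PowerSeries.X ^ 5 + (-12) * PowerSeries.X ^ 6 + (24) * PowerSeries.X ^ 7 + (-16) *
  PowerSeries.X ^ 8
noncomputable def q12 : PowerSeries ℚ :=
  (1) * PowerSeries.X ^ 4 + (-8) * PowerSeries.X ^ 5 + (26) * PowerSeries.X ^ 6 + (-41) *
  PowerSeries.X ^ 7 + (28) * PowerSeries.X ^ 8 + (-4) * PowerSeries.X ^ 9
noncomputable def q13 : PowerSeries ℚ :=
  (2) * PowerSeries.X ^ 5 + (-14) * PowerSeries.X ^ 6 + (38) * PowerSeries.X ^ 7 + (-46) *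
  PowerSeries.X ^ 8 + (20) * PowerSeries.X ^ 9
noncomputable def q14 : PowerSeries ℚ :=
  (5) * PowerSeries.X ^ 6 + (-30) * PowerSeries.X ^ 7 + (65) * PowerSeries.X ^ 8 + (-55) *
  PowerSeries.X ^ 9 + (12) * PowerSeries.X ^ 10 + (1) * PowerSeries.X ^ 11

theorem gf_quot {S : Type} [CommRing S] (Q : PowerSeries DR →+* S)
    (hQ : Function.Surjective Q) (hy : Q (PowerSeries.C yR) ^ 5 = 0) :
    Q (PowerSeries.map (algebraMap ℚ DR) ((1 - 2 * PowerSeries.X) ^ 6) * gf xR yR 0) =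
      Q (PowerSeries.map (algebraMap ℚ DR) q00 * PowerSeries.C (xR ^ 0 * yR ^ 0) +
      PowerSeries.map (algebraMap ℚ DR) q01 * PowerSeries.C (xR ^ 0 * yR ^ 1) +
      PowerSeries.map (algebraMap ℚ DR) q02 * PowerSeries.C (xR ^ 0 * yR ^ 2) +
      PowerSeries.map (algebraMap ℚ DR) q03 * PowerSeries.C (xR ^ 0 * yR ^ 3) +
      PowerSeries.map (algebraMap ℚ DR) q04 * PowerSeries.C (xR ^ 0 * yR ^ 4) +
      PowerSeries.map (algebraMap ℚ DR) q10 * PowerSeries.C (xR ^ 1 * yR ^ 0) +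
      PowerSeries.map (algebraMap ℚ DR) q11 * PowerSeries.C (xR ^ 1 * yR ^ 1) +
      PowerSeries.map (algebraMap ℚ DR) q12 * PowerSeries.C (xR ^ 1 * yR ^ 2) +
      PowerSeries.map (algebraMap ℚ DR) q13 * PowerSeries.C (xR ^ 1 * yR ^ 3) +
      PowerSeries.map (algebraMap ℚ DR) q14 * PowerSeries.C (xR ^ 1 * yR ^ 4)) := by
  have hu : ∀ s, IsUnit (1 - Q PowerSeries.X * s) := by
    intro s
    obtain ⟨s, rfl⟩ := hQ s
    have : IsUnit (1 - PowerSeries.X * s : PowerSeries DR) := by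
      rw [PowerSeries.isUnit_iff_constantCoeff]; simp
    simpa using this.map Q
  have hx : Q (PowerSeries.C xR) ^ 2 = 0 := by
    rw [← map_pow, ← map_pow, xR_sq]; simp
  have hr := fun i => congrArg Q (gf_rec xR_sq yR i)
  simp only [map_add, map_mul, map_sub, map_pow, map_one] at hr
  have key := solve_system (Q PowerSeries.X) (Q (PowerSeries.C xR)) (Q (PowerSeries.C yR))
    (Q (gf xR yR 0)) (Q (gf xR yR 1)) (Q (gf xR yR 2)) (Q (gf xR yR 3)) (Q (gf xR yR 4))
    (Q (gf xR yR 5)) hu hx hy (hr 4) (hr 3) (hr 2) (hr 1) (hr 0)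
  simp only [q00, q01, q02, q03, q04, q10, q11, q12, q13, q14, map_add, map_mul, map_sub, map_pow, map_one,
    PowerSeries.map_X, map_neg, map_ofNat]
  linear_combination key

theorem exists_of_quot {T : Type} [CommRing T] (a b c : T)
    (h : ∀ (S : Type) [CommRing S] (Q : T →+* S), Function.Surjective Q → Q c = 0 → Q a = Q b) :
    ∃ E, a = b + c * E := by
  have h := h (T ⧸ Ideal.span {c}) (Ideal.Quotient.mk _) Ideal.Quotient.mk_surjective (by
      rw [Ideal.Quotient.eq_zero_iff_mem]
      exact Ideal.mem_span_singleton_self _)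
  rw [Ideal.Quotient.eq, Ideal.mem_span_singleton] at h
  obtain ⟨E, hE⟩ := h
  exact ⟨E, by rw [← hE]; ring⟩

theorem gf_solved : ∃ E : PowerSeries DR,
    PowerSeries.map (algebraMap ℚ DR) ((1 - 2 * PowerSeries.X) ^ 6) * gf xR yR 0 =
      PowerSeries.map (algebraMap ℚ DR) q00 * PowerSeries.C (xR ^ 0 * yR ^ 0) +
      PowerSeries.map (algebraMap ℚ DR) q01 * PowerSeries.C (xR ^ 0 * yR ^ 1) +
      PowerSeries.map (algebraMap ℚ DR) q02 * PowerSeries.C (xR ^ 0 * yR ^ 2) +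
      PowerSeries.map (algebraMap ℚ DR) q03 * PowerSeries.C (xR ^ 0 * yR ^ 3) +
      PowerSeries.map (algebraMap ℚ DR) q04 * PowerSeries.C (xR ^ 0 * yR ^ 4) +
      PowerSeries.map (algebraMap ℚ DR) q10 * PowerSeries.C (xR ^ 1 * yR ^ 0) +
      PowerSeries.map (algebraMap ℚ DR) q11 * PowerSeries.C (xR ^ 1 * yR ^ 1) +
      PowerSeries.map (algebraMap ℚ DR) q12 * PowerSeries.C (xR ^ 1 * yR ^ 2) +
      PowerSeries.map (algebraMap ℚ DR) q13 * PowerSeries.C (xR ^ 1 * yR ^ 3) +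
      PowerSeries.map (algebraMap ℚ DR) q14 * PowerSeries.C (xR ^ 1 * yR ^ 4) +
      PowerSeries.C (yR ^ 5) * E := by
  refine exists_of_quot _ _ _ fun S _ Q hQ hc => gf_quot Q hQ ?_
  rw [← hc, map_pow PowerSeries.C, map_pow Q]

theorem genfun_one132_4 :
    (1 - 2 * PowerSeries.X) ^ 6 * PowerSeries.mk (fun n => (B n : ℚ)) = PowerSeries.X ^ 6 * (PowerSeries.X ^ 5 + 12 * PowerSeries.X ^ 4 - 55 * PowerSeries.X ^ 3 + 65 * PowerSeries.X ^ 2 - 30 * PowerSeries.X + 5) := by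
  obtain ⟨E, hE⟩ := gf_solved
  have hP := congrArg Phi hE
  have h5 : Phi (PowerSeries.C (yR ^ 5) * E) = 0 := by
    ext n
    simp only [Phi, PowerSeries.coeff_mk, PowerSeries.coeff_C_mul, phi_y5, map_zero]
  rw [Phi_map_mul, Phi_gf] at hP
  rw [hP]
  simp only [Phi_add, Phi_map_mul, Phi_C, phi_mon, h5]
  norm_num
  rw [q14]
  ring
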